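/- Let B be as in the wall-profile setup. Let f : ℝ × ℝ → ℂ be continuous on the closed triangle {(w,z) : 0 ≤ z ≤ w ≤ 1} and admit a partial derivative ∂f/∂w (with respect to the first variable) that is continuous and bounded on this triangle. Then the function φ(w) := (1/B(w)) · ∫₀^w B(z) f(w,z) dz is differentiable on (0,1), and φ′(w) → 0 as w → 1 from the left. -/

import Mathlib

open Filter Topology MeasureTheory

lemma leib (F F' : ℝ × ℝ → ℂ) (hF : Continuous F) (hF' : Continuous F')
    (hd : ∀ w z : ℝ, HasDerivAt (fun w' => F (w', z)) (F' (w, z)) w) (w : ℝ) :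
    HasDerivAt (fun w' : ℝ => ∫ z in (0:ℝ)..w', F (w', z))
      (F (w, w) + ∫ z in (0:ℝ)..w, F' (w, z)) w := by
  let J : ℝ → ℝ → ℂ := fun u w => ∫ z in (0:ℝ)..u, F (w, z)
  have hJ1 : ∀ u w : ℝ, HasDerivAt (fun u' => J u' w) (F (w, u)) u := by
    intro u w
    have hc : Continuous (fun z => F (w, z)) := by fun_prop
    exact intervalIntegral.integral_hasDerivAt_right (hc.intervalIntegrable _ _)
      (hc.stronglyMeasurableAtFilter _ _) hc.continuousAt
  have hJ2 : ∀ u w : ℝ, HasDerivAt (fun w' => J u w') (∫ z in (0:ℝ)..u, F' (w, z)) w := by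
    intro u w
    obtain ⟨M, hM⟩ := ((isCompact_Icc (a := w - 1) (b := w + 1)).prod
      (isCompact_uIcc (a := (0:ℝ)) (b := u))).exists_bound_of_continuousOn hF'.continuousOn
    have := intervalIntegral.hasDerivAt_integral_of_dominated_loc_of_deriv_le (μ := volume)
      (F := fun w z => F (w, z)) (F' := fun w z => F' (w, z)) (x₀ := w) (a := 0) (b := u)
      (s := Set.Icc (w - 1) (w + 1)) (bound := fun _ => M)
      (Icc_mem_nhds (by linarith) (by linarith))
      (Eventually.of_forall fun x => (by fun_prop : Continuous fun z => F (x, z)).aestronglyMeasurable)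
      ((by fun_prop : Continuous fun z => F (w, z)).intervalIntegrable _ _)
      ((by fun_prop : Continuous fun z => F' (w, z)).aestronglyMeasurable)
      (Eventually.of_forall fun t ht x hx => hM (x, t) ⟨hx, Set.uIoc_subset_uIcc ht⟩)
      (by simp)
      (Eventually.of_forall fun t _ x _ => hd x t)
    exact this.2
  have key := hasStrictFDerivAt_uncurry_coprod (𝕜 := ℝ) (u := ((w, w) : ℝ × ℝ)) (f := J)
    (f₁ := fun u w => ContinuousLinearMap.toSpanSingleton ℝ (F (w, u)))
    (f₂ := fun u w => ContinuousLinearMap.toSpanSingleton ℝ (∫ z in (0:ℝ)..u, F' (w, z)))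
    (Eventually.of_forall fun v => (hJ1 v.1 v.2).hasFDerivAt)
    (Eventually.of_forall fun v => (hJ2 v.1 v.2).hasFDerivAt)
    (by
      apply Continuous.continuousAt
      have : Continuous fun v : ℝ × ℝ => (ContinuousLinearMap.toSpanSingletonCLE (𝕜 := ℝ) (E := ℂ)) (F (v.2, v.1)) := by
        fun_prop
      exact this)
    (by
      apply Continuous.continuousAt
      have h0 : Continuous fun v : ℝ × ℝ => ∫ z in (0:ℝ)..v.1, F' (v.2, z) := by
        have := intervalIntegral.continuous_parametric_primitive_of_continuous (μ := volume)
          (f := fun w z => F' (w, z)) (a₀ := 0) (by simpa [Function.uncurry_def] using hF')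
        exact this.comp continuous_swap
      have : Continuous fun v : ℝ × ℝ => (ContinuousLinearMap.toSpanSingletonCLE (𝕜 := ℝ) (E := ℂ)) (∫ z in (0:ℝ)..v.1, F' (v.2, z)) := by
        fun_prop
      exact this)
  have h2 : HasDerivAt (fun w' : ℝ => ((w', w') : ℝ × ℝ)) (1, 1) w :=
    (hasDerivAt_id w).prodMk (hasDerivAt_id w)
  have h3 := key.hasFDerivAt.comp_hasDerivAt (f := fun w' : ℝ => ((w', w') : ℝ × ℝ)) w h2
  refine HasDerivAt.congr_deriv (f := fun w' : ℝ => ∫ z in (0:ℝ)..w', F (w', z)) h3 ?_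
  simp [Function.HasUncurry.uncurry]

lemma extend_tri (f f' : ℝ × ℝ → ℂ)
    (hfcont : ContinuousOn f {p : ℝ × ℝ | 0 ≤ p.2 ∧ p.2 ≤ p.1 ∧ p.1 ≤ 1})
    (hderiv : ∀ w z : ℝ, 0 ≤ z → z ≤ w → w ≤ 1 →
      HasDerivAt (fun w' : ℝ => f (w', z)) (f' (w, z)) w)
    (hf'cont : ContinuousOn f' {p : ℝ × ℝ | 0 ≤ p.2 ∧ p.2 ≤ p.1 ∧ p.1 ≤ 1}) :
    ∃ F F' : ℝ × ℝ → ℂ, Continuous F ∧ Continuous F' ∧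
      (∀ w z : ℝ, HasDerivAt (fun w' => F (w', z)) (F' (w, z)) w) ∧
      (∀ w z : ℝ, 0 ≤ z → z ≤ w → w ≤ 1 → F (w, z) = f (w, z)) := by
  let cl : ℝ → ℝ := fun x => max 0 (min x 1)
  have hcl : Continuous cl := by fun_prop
  have hcl0 : ∀ x, 0 ≤ cl x := fun x => le_max_left _ _
  have hcl1 : ∀ x, cl x ≤ 1 := fun x => max_le zero_le_one (min_le_right _ _)
  have hcle : ∀ x, 0 ≤ x → x ≤ 1 → cl x = x := by
    intro x h0 h1; simp [cl, h0, h1]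
  let G : ℝ × ℝ → ℂ := fun p => f' (cl p.1, min (cl p.1) (cl p.2))
  have hG : Continuous G := by
    apply hf'cont.comp_continuous (f := fun p : ℝ × ℝ => (cl p.1, min (cl p.1) (cl p.2)))
    · fun_prop
    · intro p
      exact ⟨le_min (hcl0 _) (hcl0 _), min_le_left _ _, hcl1 _⟩
  have hD : Continuous fun z => f (cl z, cl z) := by
    apply hfcont.comp_continuous (f := fun z : ℝ => (cl z, cl z))
    · fun_prop
    · intro p
      exact ⟨hcl0 _, le_rfl, hcl1 _⟩
  have hGi : ∀ z a b, IntervalIntegrable (fun s => G (s, z)) volume a b := fun z a b =>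
    (by fun_prop : Continuous fun s => G (s, z)).intervalIntegrable _ _
  refine ⟨fun p => f (cl p.2, cl p.2) + ∫ s in p.2..p.1, G (s, p.2), G, ?_, hG, ?_, ?_⟩
  · have hp := intervalIntegral.continuous_parametric_primitive_of_continuous (μ := volume)
          (f := fun z s => G (s, z)) (a₀ := 0) (by
            simp only [Function.uncurry_def]; fun_prop)
    have e : (fun p : ℝ × ℝ => ∫ s in p.2..p.1, G (s, p.2)) = fun p =>
        (∫ s in (0:ℝ)..p.1, G (s, p.2)) - ∫ s in (0:ℝ)..p.2, G (s, p.2) := by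
      ext p
      rw [intervalIntegral.integral_interval_sub_left (hGi _ _ _) (hGi _ _ _)]
    refine (hD.comp continuous_snd).add ?_
    rw [e]
    exact (hp.comp continuous_swap).sub (hp.comp (continuous_snd.prodMk continuous_snd))
  · intro w z
    have hc : Continuous (fun s => G (s, z)) := by fun_prop
    have h1 : HasDerivAt (fun w' => ∫ s in z..w', G (s, z)) (G (w, z)) w :=
      intervalIntegral.integral_hasDerivAt_right (hc.intervalIntegrable _ _)
        (hc.stronglyMeasurableAtFilter _ _) hc.continuousAt
    exact h1.const_add (f (cl z, cl z))
  · intro w z h0 h1 h2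
    have e1 : ∫ s in z..w, G (s, z) = ∫ s in z..w, f' (s, z) := by
      apply intervalIntegral.integral_congr
      intro s hs
      rw [Set.uIcc_of_le h1] at hs
      simp only [G]
      rw [hcle s (by linarith [hs.1]) (by linarith [hs.2]), hcle z h0 (by linarith),
        min_eq_right hs.1]
    have e2 : ∫ s in z..w, f' (s, z) = f (w, z) - f (z, z) := by
      apply intervalIntegral.integral_eq_sub_of_hasDerivAt (f := fun s => f (s, z))
      · intro s hs
        rw [Set.uIcc_of_le h1] at hs
        exact hderiv s z h0 hs.1 (by linarith [hs.2])
      · apply ContinuousOn.intervalIntegrable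
        apply hf'cont.comp (f := fun s : ℝ => (s, z)) (by fun_prop)
        intro s hs
        rw [Set.uIcc_of_le h1] at hs
        exact ⟨h0, hs.1, by simpa using hs.2.trans h2⟩
    simp only [e1, e2, hcle z h0 (by linarith)]
    ring

lemma avg (B A η : ℝ → ℝ) (hBc : ContinuousOn B (Set.Iio 1)) (hBpos : ∀ z < 1, 0 < B z)
    (hA : ∀ z ∈ Set.Ioo (0:ℝ) 1, HasDerivAt A (B z * (1 + η z)) z)
    (hηc : ContinuousOn η (Set.Ioo 0 1)) (hη : Tendsto η (𝓝[<] 1) (𝓝 0))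
    (hAt : Tendsto A (𝓝[<] 1) atTop) (F : ℝ × ℝ → ℂ) (hF : Continuous F) :
    Tendsto (fun w => ((A w : ℂ))⁻¹ * ∫ z in (0:ℝ)..w, (B z : ℂ) * F (w, z))
      (𝓝[<] 1) (𝓝 (F (1, 1))) := by
  set L := F (1, 1) with hL
  rw [Metric.tendsto_nhds]
  intro ε hε
  -- choose w0
  have hF1 : ∀ᶠ p in 𝓝[<] (1:ℝ) ×ˢ 𝓝[<] (1:ℝ), ‖F p - L‖ < ε / 8 := by
    have : Tendsto F (𝓝 ((1:ℝ), (1:ℝ))) (𝓝 L) := hF.tendsto _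
    have h1 := (Metric.tendsto_nhds.1 this) (ε / 8) (by positivity)
    rw [nhds_prod_eq] at h1
    have h2 := h1.filter_mono (Filter.prod_mono (nhdsWithin_le_nhds (s := Set.Iio (1:ℝ)))
      (nhdsWithin_le_nhds (s := Set.Iio (1:ℝ))))
    simpa only [dist_eq_norm] using h2
  have hη1 : ∀ᶠ z in 𝓝[<] (1:ℝ), |η z| < 1 / 2 := by
    simpa using (Metric.tendsto_nhds.1 hη) (1/2) (by positivity)
  have hη2 : ∀ᶠ z in 𝓝[<] (1:ℝ), ‖L‖ * |η z| < ε / 8 := by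
    have : Tendsto (fun z => ‖L‖ * |η z|) (𝓝[<] 1) (𝓝 (‖L‖ * |0|)) := hη.abs.const_mul _
    rw [abs_zero, mul_zero] at this
    exact this.eventually (gt_mem_nhds (by positivity))
  obtain ⟨w0, hw0, hw⟩ : ∃ w0 ∈ Set.Ioo (0:ℝ) 1, ∀ z ∈ Set.Ico w0 1, 
      (|η z| < 1/2 ∧ ‖L‖ * |η z| < ε / 8) ∧ ∀ w ∈ Set.Ico w0 1, ‖F (w, z) - L‖ < ε / 8 := by
    obtain ⟨pa, ha, pb, hb, hab⟩ := Filter.eventually_prod_iff.1 hF1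
    have hall := ((ha.and hb).and (hη1.and hη2)).and (Ioo_mem_nhdsLT (zero_lt_one (α := ℝ)))
    obtain ⟨l, hl, hl'⟩ := (mem_nhdsLT_iff_exists_Ioo_subset' (zero_lt_one (α := ℝ))).1 hall
    have hl1 : l < 1 := hl
    refine ⟨(max l 0 + 1) / 2, ⟨?_, ?_⟩, ?_⟩
    · linarith [le_max_right l 0]
    · linarith [max_lt hl1 one_pos]
    · have : l < (max l 0 + 1) / 2 := by linarith [max_lt hl1 one_pos, le_max_left l 0]
      intro z hz
      have hz' := hl' ⟨this.trans_le hz.1, hz.2⟩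
      refine ⟨hz'.1.2, fun w hw => ?_⟩
      have hw' := hl' ⟨this.trans_le hw.1, hw.2⟩
      exact hab hw'.1.1.1 hz'.1.1.2
  obtain ⟨M, hM⟩ := ((isCompact_Icc (a := (0:ℝ)) (b := 1)).prod
      (isCompact_Icc (a := (0:ℝ)) (b := 1))).exists_bound_of_continuousOn hF.continuousOn
  obtain ⟨N, hN⟩ := (isCompact_Icc (a := (0:ℝ)) (b := w0)).exists_bound_of_continuousOn
    (hBc.mono fun x hx => lt_of_le_of_lt hx.2 hw0.2)
  set K := N * M + ‖L‖ * |A w0| + ε / 2 * |A w0| with hK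
  have main : ∀ w ∈ Set.Ioo w0 1,
      ‖(∫ z in (0:ℝ)..w, (B z : ℂ) * F (w, z)) - L * A w‖ ≤ K + ε / 2 * A w := by
    intro w hww
    have hcont : ∀ a b, a < 1 → b < 1 → IntervalIntegrable (fun z => (B z : ℂ) * F (w, z)) volume a b := by
      intro a b ha hb
      apply ContinuousOn.intervalIntegrable
      have : ContinuousOn B (Set.uIcc a b) := hBc.mono fun x hx => lt_of_le_of_lt hx.2 (max_lt ha hb)
      have h2 : ContinuousOn (fun z => (B z : ℂ)) (Set.uIcc a b) :=
        Complex.continuous_ofReal.comp_continuousOn this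
      exact h2.mul (by fun_prop : Continuous fun z => F (w, z)).continuousOn
    have hsub : Set.uIcc w0 w ⊆ Set.Ico w0 1 := by
      rw [Set.uIcc_of_le hww.1.le]
      exact fun x hx => ⟨hx.1, hx.2.trans_lt hww.2⟩
    have hAc : ContinuousOn (fun z => B z * (1 + η z)) (Set.uIcc w0 w) := by
      apply (hBc.mono fun x hx => (hsub hx).2).mul
      exact continuousOn_const.add (hηc.mono fun x hx => ⟨hw0.1.trans_le (hsub hx).1, (hsub hx).2⟩)
    have hAint : ∫ z in w0..w, B z * (1 + η z) = A w - A w0 := by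
      apply intervalIntegral.integral_eq_sub_of_hasDerivAt
      · intro x hx
        exact hA x ⟨hw0.1.trans_le (hsub hx).1, (hsub hx).2⟩
      · exact hAc.intervalIntegrable
    have hAint' : ∫ z in w0..w, L * ((B z * (1 + η z) : ℝ) : ℂ) = L * (A w - A w0) := by
      rw [intervalIntegral.integral_const_mul, intervalIntegral.integral_ofReal, hAint]
      push_cast; ring
    have hI2 : IntervalIntegrable (fun z => L * ((B z * (1 + η z) : ℝ) : ℂ)) volume w0 w := by
      apply ContinuousOn.intervalIntegrable
      exact continuousOn_const.mul (Complex.continuous_ofReal.comp_continuousOn hAc)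
    have hsplit : (∫ z in (0:ℝ)..w, (B z : ℂ) * F (w, z)) - L * A w =
        ((∫ z in (0:ℝ)..w0, (B z : ℂ) * F (w, z)) - L * A w0) +
        ∫ z in w0..w, ((B z : ℂ) * F (w, z) - L * ((B z * (1 + η z) : ℝ) : ℂ)) := by
      rw [intervalIntegral.integral_sub (hcont _ _ hw0.2 hww.2) hI2, hAint',
        ← intervalIntegral.integral_add_adjacent_intervals (hcont 0 w0 one_pos hw0.2)
          (hcont w0 w hw0.2 hww.2)]
      ring
    have hb1 : ‖∫ z in (0:ℝ)..w0, (B z : ℂ) * F (w, z)‖ ≤ N * M := by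
      have hN0 : 0 ≤ N := (norm_nonneg _).trans (hN 0 ⟨le_rfl, hw0.1.le⟩)
      have hM0 : 0 ≤ M := (norm_nonneg _).trans (hM (0, 0) (by simp))
      have := intervalIntegral.norm_integral_le_of_norm_le_const (a := 0) (b := w0)
        (f := fun z => (B z : ℂ) * F (w, z)) (C := N * M) (by
          intro z hz
          rw [Set.uIoc_of_le hw0.1.le] at hz
          rw [norm_mul, Complex.norm_real]
          exact mul_le_mul (hN z ⟨hz.1.le, hz.2⟩)
            (hM (w, z) ⟨⟨(hw0.1.trans hww.1).le, hww.2.le⟩, ⟨hz.1.le, hz.2.trans hw0.2.le⟩⟩)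
            (norm_nonneg _) hN0)
      refine this.trans ?_
      rw [sub_zero, abs_of_pos hw0.1]
      exact mul_le_of_le_one_right (by positivity) hw0.2.le
    have hb2 : ‖∫ z in w0..w, ((B z : ℂ) * F (w, z) - L * ((B z * (1 + η z) : ℝ) : ℂ))‖
        ≤ ε / 2 * (A w - A w0) := by
      rw [← hAint, ← intervalIntegral.integral_const_mul]
      apply intervalIntegral.norm_integral_le_of_norm_le hww.1.le
      · refine Eventually.of_forall fun z hz => ?_
        obtain ⟨⟨h1, h2⟩, h3⟩ := hw z ⟨hz.1.le, hz.2.trans_lt hww.2⟩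
        have h4 := h3 w ⟨hww.1.le, hww.2⟩
        have hBz := hBpos z (hz.2.trans_lt hww.2)
        have e : (B z : ℂ) * F (w, z) - L * ((B z * (1 + η z) : ℝ) : ℂ)
          = (B z : ℂ) * ((F (w, z) - L) - L * (η z : ℂ)) := by push_cast; ring
        rw [e, norm_mul, Complex.norm_real, Real.norm_of_nonneg hBz.le, mul_left_comm]
        apply mul_le_mul_of_nonneg_left _ hBz.le
        refine (norm_sub_le _ _).trans ?_
        rw [norm_mul, Complex.norm_real, Real.norm_eq_abs]
        have := (abs_lt.1 h1).1
        nlinarith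
      · exact (continuousOn_const.mul hAc).intervalIntegrable
    rw [hsplit]
    refine (norm_add_le _ _).trans ?_
    have hb3 := norm_sub_le (∫ z in (0:ℝ)..w0, (B z : ℂ) * F (w, z)) (L * A w0)
    rw [norm_mul, Complex.norm_real, Real.norm_eq_abs] at hb3
    have := mul_le_mul_of_nonneg_left (neg_abs_le (A w0)) (by positivity : 0 ≤ ε / 2)
    rw [hK]
    linarith
  filter_upwards [Ioo_mem_nhdsLT hw0.2, hAt.eventually_gt_atTop 0,
    hAt.eventually_gt_atTop (4 * K / ε)] with w hww hA0 hAK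
  have hm := main w hww
  have hAne : (A w : ℂ) ≠ 0 := by exact_mod_cast hA0.ne'
  have e : ((A w : ℂ))⁻¹ * (∫ z in (0:ℝ)..w, (B z : ℂ) * F (w, z)) - L =
      ((A w : ℂ))⁻¹ * ((∫ z in (0:ℝ)..w, (B z : ℂ) * F (w, z)) - L * A w) := by
    field_simp
  rw [dist_eq_norm, e, norm_mul, norm_inv, Complex.norm_real, Real.norm_of_nonneg hA0.le,
    inv_mul_lt_iff₀ hA0]
  rw [div_lt_iff₀ hε] at hAK
  nlinarith

lemma setup_facts
    (h : ℝ → ℝ) (hsmooth : ContDiff ℝ (⊤ : ℕ∞) h)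
    (hle : ∀ z : ℝ, z ≤ 0 → h z = Real.pi / 2)
    (hmid : ∀ z : ℝ, 0 < z → z < 1 → 0 < h z ∧ h z < Real.pi / 2)
    (hge : ∀ z : ℝ, 1 ≤ z → h z = 0)
    (B : ℝ → ℝ)
    (hB : ∀ y : ℝ, y < 1 → B y = Real.exp (∫ z in (0:ℝ)..y, Real.cot (h z))) :
    (∀ y < 1, 0 < B y) ∧ (∀ y < 1, HasDerivAt B (Real.cot (h y) * B y) y) ∧
    ∃ t η : ℝ → ℝ, (∀ z ∈ Set.Ioo (0:ℝ) 1, 0 < t z ∧ Real.cot (h z) = (t z)⁻¹ ∧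
      HasDerivAt (fun z => t z * B z) (B z * (1 + η z)) z) ∧
      ContinuousOn η (Set.Ioo 0 1) ∧ Tendsto η (𝓝[<] 1) (𝓝 0) ∧ Tendsto t (𝓝[<] 1) (𝓝 0) ∧
      Tendsto (fun z => t z * B z) (𝓝[<] 1) atTop := by
  have hcont : Continuous h := hsmooth.continuous
  have hrange : ∀ z < 1, 0 < h z ∧ h z < Real.pi := by
    intro z hz
    rcases le_or_gt z 0 with h0 | h0
    · rw [hle z h0]; constructor <;> linarith [Real.pi_pos]
    · exact ⟨(hmid z h0 hz).1, by linarith [(hmid z h0 hz).2, Real.pi_pos]⟩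
  have hcotc : ContinuousOn (fun z => Real.cot (h z)) (Set.Iio 1) := by
    simp only [Real.cot_eq_cos_div_sin]
    apply ContinuousOn.div (by fun_prop) (by fun_prop)
    intro z hz
    exact (Real.sin_pos_of_pos_of_lt_pi (hrange z hz).1 (hrange z hz).2).ne'
  have hBpos : ∀ y < 1, 0 < B y := fun y hy => by rw [hB y hy]; exact Real.exp_pos _
  have hBd : ∀ y < 1, HasDerivAt B (Real.cot (h y) * B y) y := by
    intro y hy
    have hi : IntervalIntegrable (fun z => Real.cot (h z)) volume 0 y :=
      (hcotc.mono fun x hx => lt_of_le_of_lt hx.2 (max_lt one_pos hy)).intervalIntegrable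
    have h1 := (intervalIntegral.integral_hasDerivAt_right hi
      (hcotc.stronglyMeasurableAtFilter isOpen_Iio y hy)
      (hcotc.continuousAt (Iio_mem_nhds hy))).exp
    have h2 : B =ᶠ[𝓝 y] fun y => Real.exp (∫ z in (0:ℝ)..y, Real.cot (h z)) := by
      filter_upwards [Iio_mem_nhds hy] with x hx using hB x hx
    rw [hB y hy, mul_comm]
    exact h1.congr_of_eventuallyEq h2
  refine ⟨hBpos, hBd, fun z => Real.tan (h z), fun z => deriv h z / Real.cos (h z) ^ 2, ?_⟩
  have hdc : Continuous (deriv h) := hsmooth.continuous_deriv (by simp)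
  have hdh : ∀ z, HasDerivAt h (deriv h z) z := fun z =>
    (hsmooth.differentiable (by simp) z).hasDerivAt
  have hcos : ∀ z ∈ Set.Ioo (0:ℝ) 1, 0 < Real.cos (h z) := fun z hz =>
    Real.cos_pos_of_mem_Ioo ⟨by linarith [(hmid z hz.1 hz.2).1, Real.pi_pos], (hmid z hz.1 hz.2).2⟩
  have htan : ∀ z ∈ Set.Ioo (0:ℝ) 1, 0 < Real.tan (h z) := fun z hz =>
    Real.tan_pos_of_pos_of_lt_pi_div_two (hmid z hz.1 hz.2).1 (hmid z hz.1 hz.2).2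
  have hcot : ∀ z, Real.cot (h z) = (Real.tan (h z))⁻¹ := fun z => by
    rw [Real.cot_eq_cos_div_sin, Real.tan_eq_sin_div_cos, inv_div]
  have hd1 : deriv h 1 = 0 := by
    have h1 : Tendsto (deriv h) (𝓝[>] 1) (𝓝 (deriv h 1)) := (hdc.tendsto 1).mono_left nhdsWithin_le_nhds
    have h2 : Tendsto (deriv h) (𝓝[>] 1) (𝓝 0) := by
      apply tendsto_const_nhds.congr'
      filter_upwards [self_mem_nhdsWithin] with x hx
      have : h =ᶠ[𝓝 x] fun _ => 0 := by
        filter_upwards [Ioi_mem_nhds hx] with y hy using hge y (le_of_lt hy)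
      rw [this.deriv_eq]; simp
    exact tendsto_nhds_unique h1 h2
  have h1z : h 1 = 0 := hge 1 le_rfl
  have hηt : Tendsto (fun z => deriv h z / Real.cos (h z) ^ 2) (𝓝[<] 1) (𝓝 0) := by
    have : ContinuousAt (fun z => deriv h z / Real.cos (h z) ^ 2) 1 := by
      apply ContinuousAt.div (by fun_prop) (by fun_prop)
      simp [h1z]
    have h2 := this.tendsto
    simp only [hd1, zero_div] at h2
    exact h2.mono_left nhdsWithin_le_nhds
  have htt : Tendsto (fun z => Real.tan (h z)) (𝓝[<] 1) (𝓝 0) := by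
    have : ContinuousAt (fun z => Real.tan (h z)) 1 := by
      have h3 : ContinuousAt Real.tan (h 1) := Real.continuousAt_tan.2 (by simp [h1z])
      exact h3.comp hcont.continuousAt
    have h2 := this.tendsto
    simp only [h1z, Real.tan_zero] at h2
    exact h2.mono_left nhdsWithin_le_nhds
  have htd : ∀ z ∈ Set.Ioo (0:ℝ) 1,
      HasDerivAt (fun z => Real.tan (h z)) (deriv h z / Real.cos (h z) ^ 2) z := by
    intro z hz
    have := (Real.hasDerivAt_tan (hcos z hz).ne').comp z (hdh z)
    refine HasDerivAt.congr_deriv this ?_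
    ring
  have hAd : ∀ z ∈ Set.Ioo (0:ℝ) 1, HasDerivAt (fun z => Real.tan (h z) * B z)
      (B z * (1 + deriv h z / Real.cos (h z) ^ 2)) z := by
    intro z hz
    have := (htd z hz).mul (hBd z hz.2)
    refine HasDerivAt.congr_deriv this ?_
    have ht := (htan z hz).ne'
    rw [hcot, mul_inv_cancel_left₀ ht]; ring
  refine ⟨fun z hz => ⟨htan z hz, hcot z, hAd z hz⟩, ?_, hηt, htt, ?_⟩
  · apply ContinuousOn.div (by fun_prop) (by fun_prop)
    intro z hz
    exact pow_ne_zero _ (hcos z hz).ne'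
  · have hη1 : ∀ᶠ z in 𝓝[<] (1:ℝ), -(1/2) < deriv h z / Real.cos (h z) ^ 2 :=
      hηt.eventually (lt_mem_nhds (by norm_num))
    have hall := hη1.and (Ioo_mem_nhdsLT (zero_lt_one (α := ℝ)))
    obtain ⟨l, hl, hl'⟩ := (mem_nhdsLT_iff_exists_Ioo_subset' (zero_lt_one (α := ℝ))).1 hall
    have hl1 : l < 1 := hl
    have hmono : MonotoneOn (fun z => Real.tan (h z) * (Real.tan (h z) * B z)) (Set.Ioo l 1) := by
      have hD : ∀ z ∈ Set.Ioo l 1, HasDerivAt (fun z => Real.tan (h z) * (Real.tan (h z) * B z))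
          (Real.tan (h z) * B z * (1 + 2 * (deriv h z / Real.cos (h z) ^ 2))) z := by
        intro z hz
        have hz' := (hl' hz).2
        have := (htd z hz').mul (hAd z hz')
        refine HasDerivAt.congr_deriv this ?_
        ring
      apply monotoneOn_of_deriv_nonneg (convex_Ioo _ _)
      · exact fun z hz => (hD z hz).continuousAt.continuousWithinAt
      · rw [interior_Ioo]
        exact fun z hz => (hD z hz).differentiableAt.differentiableWithinAt
      · rw [interior_Ioo]
        intro z hz
        rw [(hD z hz).deriv]
        have h1 : -(1/2) < deriv h z / Real.cos (h z) ^ 2 := (hl' hz).1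
        have h2 := htan z (hl' hz).2
        have h3 := hBpos z hz.2
        apply mul_nonneg (by positivity)
        linarith
    set m := (l + 1) / 2 with hm
    have hmm : m ∈ Set.Ioo l 1 := ⟨by linarith, by linarith⟩
    have hc : 0 < Real.tan (h m) * (Real.tan (h m) * B m) := by
      have h2 := htan m (hl' hmm).2
      have h3 := hBpos m hmm.2
      positivity
    have hinv : Tendsto (fun z => (Real.tan (h z))⁻¹) (𝓝[<] 1) atTop := by
      apply Tendsto.inv_tendsto_nhdsGT_zero
      apply tendsto_nhdsWithin_of_tendsto_nhds_of_eventually_within _ htt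
      filter_upwards [Ioo_mem_nhdsLT (zero_lt_one (α := ℝ))] with z hz using htan z hz
    refine tendsto_atTop_mono' _ ?_ (hinv.const_mul_atTop hc)
    filter_upwards [Ioo_mem_nhdsLT hmm.2] with z hz
    have hzl : z ∈ Set.Ioo l 1 := ⟨hmm.1.trans hz.1, hz.2⟩
    have h1 := hmono hmm hzl hz.1.le
    have h2 := htan z (hl' hzl).2
    rw [mul_inv_le_iff₀ h2]
    simpa [mul_comm, mul_left_comm] using h1

/-- Lemma 1(ii) of Appendix C: for `B` as in the wall-profile setup and
`f : ℝ × ℝ → ℂ` continuous on the closed triangle `{(w,z) : 0 ≤ z ≤ w ≤ 1}`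
with a partial derivative `∂f/∂w = f'` that is continuous and bounded on the triangle,
the function `φ(w) = (1/B(w)) ∫₀^w B(z) f(w,z) dz` is differentiable on `(0,1)`
and `φ′(w) → 0` as `w → 1⁻`. -/
theorem stmt_1
    (h : ℝ → ℝ) (hsmooth : ContDiff ℝ (⊤ : ℕ∞) h)
    (hle : ∀ z : ℝ, z ≤ 0 → h z = Real.pi / 2)
    (hmid : ∀ z : ℝ, 0 < z → z < 1 → 0 < h z ∧ h z < Real.pi / 2)
    (hge : ∀ z : ℝ, 1 ≤ z → h z = 0)
    (B : ℝ → ℝ)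
    (hB : ∀ y : ℝ, y < 1 → B y = Real.exp (∫ z in (0:ℝ)..y, Real.cot (h z)))
    (f f' : ℝ × ℝ → ℂ)
    (hfcont : ContinuousOn f {p : ℝ × ℝ | 0 ≤ p.2 ∧ p.2 ≤ p.1 ∧ p.1 ≤ 1})
    (hderiv : ∀ w z : ℝ, 0 ≤ z → z ≤ w → w ≤ 1 →
      HasDerivAt (fun w' : ℝ => f (w', z)) (f' (w, z)) w)
    (hf'cont : ContinuousOn f' {p : ℝ × ℝ | 0 ≤ p.2 ∧ p.2 ≤ p.1 ∧ p.1 ≤ 1})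
    (hf'bdd : ∃ C : ℝ, ∀ w z : ℝ, 0 ≤ z → z ≤ w → w ≤ 1 → ‖f' (w, z)‖ ≤ C) :
    (∀ w ∈ Set.Ioo (0:ℝ) 1,
        DifferentiableAt ℝ
          (fun w' : ℝ => ((B w' : ℂ))⁻¹ * ∫ z in Set.Ioo (0:ℝ) w', (B z : ℂ) * f (w', z)) w) ∧
      Tendsto
        (deriv (fun w' : ℝ => ((B w' : ℂ))⁻¹ * ∫ z in Set.Ioo (0:ℝ) w', (B z : ℂ) * f (w', z)))
        (𝓝[<] (1:ℝ)) (𝓝 0) := by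
  obtain ⟨hBpos, hBd, t, η, ht, hηc, hη, ht0, hAt⟩ := setup_facts h hsmooth hle hmid hge B hB
  obtain ⟨F, F', hF, hF', hFd, hFf⟩ := extend_tri f f' hfcont hderiv hf'cont
  have hBc : ContinuousOn B (Set.Iio 1) := fun y hy =>
    (hBd y hy).continuousAt.continuousWithinAt
  have hI : ∀ w ∈ Set.Ioo (0:ℝ) 1, ∫ z in Set.Ioo (0:ℝ) w, (B z : ℂ) * f (w, z) =
      ∫ z in (0:ℝ)..w, (B z : ℂ) * F (w, z) := by
    intro w hw
    rw [intervalIntegral.integral_of_le hw.1.le, integral_Ioc_eq_integral_Ioo]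
    apply setIntegral_congr_fun measurableSet_Ioo
    intro z hz
    simp only
    rw [hFf w z hz.1.le hz.2.le hw.2.le]
  have hder : ∀ w ∈ Set.Ioo (0:ℝ) 1, HasDerivAt
      (fun w' : ℝ => ((B w' : ℂ))⁻¹ * ∫ z in Set.Ioo (0:ℝ) w', (B z : ℂ) * f (w', z))
      (F (w, w) - (((t w * B w : ℝ) : ℂ))⁻¹ * (∫ z in (0:ℝ)..w, (B z : ℂ) * F (w, z)) +
        (t w : ℂ) * ((((t w * B w : ℝ) : ℂ))⁻¹ * ∫ z in (0:ℝ)..w, (B z : ℂ) * F' (w, z))) w := by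
    intro w hw
    obtain ⟨r, hwr, hr1⟩ := exists_between hw.2
    let b : ℝ → ℝ := fun z => B (min z r)
    have hb : Continuous b := hBc.comp_continuous (by fun_prop)
      (fun z => (min_le_right z r).trans_lt hr1)
    have hbB : ∀ w' : ℝ, 0 ≤ w' → w' < r → ∀ G : ℝ × ℝ → ℂ,
        ∫ z in (0:ℝ)..w', (b z : ℂ) * G (w', z) = ∫ z in (0:ℝ)..w', (B z : ℂ) * G (w', z) := by
      intro w' h0 h1 G
      apply intervalIntegral.integral_congr
      intro z hz
      rw [Set.uIcc_of_le h0] at hz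
      simp only [b]
      rw [min_eq_left (hz.2.trans h1.le)]
    have hl := leib (fun p => (b p.2 : ℂ) * F p) (fun p => (b p.2 : ℂ) * F' p)
      (by fun_prop) (by fun_prop) (fun w z => (hFd w z).const_mul (b z : ℂ)) w
    simp only at hl
    rw [hbB w hw.1.le hwr F'] at hl
    have hbw : b w = B w := by simp only [b]; rw [min_eq_left hwr.le]
    rw [hbw] at hl
    have hBw : (B w : ℂ) ≠ 0 := by exact_mod_cast (hBpos w hw.2).ne'
    have htw : (t w : ℂ) ≠ 0 := by exact_mod_cast (ht w hw).1.ne'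
    have hinv := (hBd w hw.2).ofReal_comp.inv hBw
    have hp := hinv.mul hl
    rw [hbB w hw.1.le hwr F, (ht w hw).2.1] at hp
    have hp2 := hp.congr_of_eventuallyEq
      (f₁ := fun w' : ℝ => ((B w' : ℂ))⁻¹ * ∫ z in Set.Ioo (0:ℝ) w', (B z : ℂ) * f (w', z)) (by
        filter_upwards [Ioo_mem_nhds hw.1 hwr] with x hx
        rw [hI x ⟨hx.1, hx.2.trans hr1⟩, ← hbB x hx.1.le hx.2 F]
        rfl)
    refine HasDerivAt.congr_deriv hp2 ?_
    push_cast
    simp only [Pi.inv_apply]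
    field_simp
    ring
  refine ⟨fun w hw => (hder w hw).differentiableAt, ?_⟩
  have hA := fun z hz => (ht z hz).2.2
  have l1 := avg B (fun z => t z * B z) η hBc hBpos hA hηc hη hAt F hF
  have l2 := avg B (fun z => t z * B z) η hBc hBpos hA hηc hη hAt F' hF'
  have l0 : Tendsto (fun w : ℝ => F (w, w)) (𝓝[<] 1) (𝓝 (F (1, 1))) :=
    ((by fun_prop : Continuous fun w : ℝ => F (w, w)).tendsto 1).mono_left nhdsWithin_le_nhds
  have l3 : Tendsto (fun w : ℝ => (t w : ℂ)) (𝓝[<] 1) (𝓝 ((0 : ℝ) : ℂ)) :=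
    (Complex.continuous_ofReal.tendsto 0).comp ht0
  have l4 := (l0.sub l1).add (l3.mul l2)
  rw [Complex.ofReal_zero, zero_mul, add_zero, sub_self] at l4
  refine l4.congr' ?_
  filter_upwards [Ioo_mem_nhdsLT (zero_lt_one (α := ℝ))] with w hw
  rw [(hder w hw).deriv]
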